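/- Let t_0 ∈ {1,…,T} and let d_s be an even positive integer dividing (d_in + 1)d. For any feedforward ReLU network Ñ ∈ FNN_{d_in·t_0, d_out}(d, L), there exists a deep ParaRNN N with input dimension d_in, output dimension d_out, width (d_in + 1)d + d_s, block size d_s, and depth 2(T + L − 1) such that Ñ(x_1,…,x_{t_0}) = N(X)[t_0] for every X = (x_1,…,x_T) ∈ [0,1]^{d_in×T}, where the FNN input is the vectorization of the first t_0 columns of X. -/

import Mathlib

open Matrix MeasureTheory

noncomputable section

/-- The ReLU activation function. -/
def relu (x : ℝ) : ℝ := max x 0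

/-- A ParaRNN recurrent layer of width `d`: recurrent weights `Wh`, input weights `Wx`,
bias `b`, and initial hidden state `h0`. -/
structure RecLayer (d : ℕ) where
  Wh : Matrix (Fin d) (Fin d) ℝ
  Wx : Matrix (Fin d) (Fin d) ℝ
  b : Fin d → ℝ
  h0 : Fin d → ℝ

/-- The recurrent matrix is block diagonal with diagonal blocks of size `ds × ds`
(coordinates `i` and `j` interact only if they lie in the same block `⌊i/ds⌋ = ⌊j/ds⌋`). -/
def RecLayer.BlockDiag {d : ℕ} (ds : ℕ) (ℓ : RecLayer d) : Prop :=
  ∀ i j : Fin d, (i : ℕ) / ds ≠ (j : ℕ) / ds → ℓ.Wh i j = 0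

/-- Hidden states of a recurrent layer on the (0-indexed) input sequence `u`:
`state 0 = h0` and `state (t+1) = ReLU (Wh ⬝ state t + Wx ⬝ u t + b)`. -/
def RecLayer.state {d : ℕ} (ℓ : RecLayer d) (u : ℕ → Fin d → ℝ) : ℕ → Fin d → ℝ
  | 0 => ℓ.h0
  | t + 1 => fun i => relu (ℓ.Wh.mulVec (RecLayer.state ℓ u t) i + ℓ.Wx.mulVec (u t) i + ℓ.b i)

/-- The output sequence of a recurrent layer: position `t` (0-indexed) carries the hidden
state after consuming inputs `u 0, …, u t`. -/
def RecLayer.out {d : ℕ} (ℓ : RecLayer d) (u : ℕ → Fin d → ℝ) : ℕ → Fin d → ℝ :=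
  fun t => ℓ.state u (t + 1)

/-- A deep ParaRNN `N = Q ∘ F ∘ R_L ∘ ⋯ ∘ R_1 ∘ P` with input dimension `din`, output
dimension `dout`, width `d`, block size `ds`, and depth `L`. -/
structure ParaNet (din dout d ds L : ℕ) where
  P : Matrix (Fin d) (Fin din) ℝ
  layer : Fin L → RecLayer d
  blockdiag : ∀ l, (layer l).BlockDiag ds
  Wf : Matrix (Fin d) (Fin d) ℝ
  bf : Fin d → ℝ
  Q : Matrix (Fin dout) (Fin d) ℝ

/-- Sequential application of a list of recurrent layers. -/
def applyLayers {d : ℕ} (ls : List (RecLayer d)) (u : ℕ → Fin d → ℝ) : ℕ → Fin d → ℝ :=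
  ls.foldl (fun v ℓ => ℓ.out v) u

/-- The output sequence of a deep ParaRNN on a (0-indexed) input sequence: position `t`
is the paper's output `N(X)[t+1]`. -/
def ParaNet.forward {din dout d ds L : ℕ} (net : ParaNet din dout d ds L)
    (X : ℕ → Fin din → ℝ) : ℕ → Fin dout → ℝ :=
  fun t => net.Q.mulVec fun i =>
    relu ((net.Wf.mulVec
        (applyLayers (List.ofFn net.layer) (fun s => net.P.mulVec (X s)) t)) i + net.bf i)

/-- Extend a length-`T` input sequence by zero; the ParaRNN output at positions `< T` only
depends on the first `T` inputs. -/
def extendInput {din T : ℕ} (X : Fin T → Fin din → ℝ) : ℕ → Fin din → ℝ :=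
  fun t => if h : t < T then X ⟨t, h⟩ else 0

/-- `sup_{X ∈ ℝ^{din×T}, 1 ≤ t ≤ T} ‖N(X)[t]‖_∞ ≤ U`. -/
def ParaNet.Bounded {din dout d ds L : ℕ} (net : ParaNet din dout d ds L)
    (T : ℕ) (U : ℝ) : Prop :=
  ∀ (X : Fin T → Fin din → ℝ) (t : ℕ), t < T → ∀ i, |net.forward (extendInput X) t i| ≤ U

/-- The ParaRNN function class `F^{(T)}_{din,dout,d,ds,L,U}`: maps `X ↦ N(X)[T]` for deep
ParaRNNs `N` with all outputs bounded by `U` in sup norm. -/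
def ParaClass (din dout d ds L T : ℕ) (U : ℝ) :
    Set ((Fin T → Fin din → ℝ) → Fin dout → ℝ) :=
  {f | ∃ net : ParaNet din dout d ds L, net.Bounded T U ∧
        ∀ X, f X = net.forward (extendInput X) (T - 1)}

/-- The scalar-output ParaRNN class `F^{(T)}_{din,1,d,ds,L,U}`, with outputs in `ℝ`. -/
def scalarClass (din d ds L T : ℕ) (U : ℝ) : Set ((Fin T → Fin din → ℝ) → ℝ) :=
  {f | ∃ net : ParaNet din 1 d ds L, net.Bounded T U ∧
        ∀ X, f X = net.forward (extendInput X) (T - 1) 0}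

end

noncomputable section

/-- The hidden layers of a ReLU feedforward network: `fnnSeq … l` is the output of the
`l`-th hidden (ReLU) layer. -/
def fnnSeq (dims : ℕ → ℕ) (A : ∀ l : ℕ, Matrix (Fin (dims (l + 1))) (Fin (dims l)) ℝ)
    (c : ∀ l : ℕ, Fin (dims (l + 1)) → ℝ) (x : Fin (dims 0) → ℝ) :
    ∀ l : ℕ, Fin (dims l) → ℝ
  | 0 => x
  | l + 1 => fun i => relu ((A l).mulVec (fnnSeq dims A c x l) i + c l i)

/-- The output of a depth-`L` feedforward network: `L − 1` ReLU layers followed by an affine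
layer. -/
def fnnOut (dims : ℕ → ℕ) (A : ∀ l : ℕ, Matrix (Fin (dims (l + 1))) (Fin (dims l)) ℝ)
    (c : ∀ l : ℕ, Fin (dims (l + 1)) → ℝ) (L : ℕ) (x : Fin (dims 0) → ℝ) :
    Fin (dims L) → ℝ :=
  match L with
  | 0 => x
  | l + 1 => fun i => (A l).mulVec (fnnSeq dims A c x l) i + c l i

/-- Membership in `FNN_{p,q}(dmax, L)`: `g` is realized by a ReLU feedforward network of
depth `L` whose layer widths are all at most `dmax`. -/
def MemFNN (p q dmax L : ℕ) (g : (Fin p → ℝ) → Fin q → ℝ) : Prop :=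
  ∃ (dims : ℕ → ℕ) (h0 : dims 0 = p) (hL : dims L = q)
    (A : ∀ l : ℕ, Matrix (Fin (dims (l + 1))) (Fin (dims l)) ℝ)
    (c : ∀ l : ℕ, Fin (dims (l + 1)) → ℝ),
    (∀ l ≤ L, dims l ≤ dmax) ∧
    ∀ (x : Fin p → ℝ) (i : Fin q),
      g x i = fnnOut dims A c L (fun j => x (Fin.cast h0 j)) (Fin.cast hL.symm i)

/-- Vectorization (column stacking) of the first `t0` columns of `X ∈ ℝ^{din×T}`. -/
def vecCols {din T : ℕ} (t0 : ℕ) (ht : t0 ≤ T) (X : Fin T → Fin din → ℝ) :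
    Fin (din * t0) → ℝ :=
  fun j => X
    ⟨(j : ℕ) / din, by
      have h1 := j.isLt
      have hd : 0 < din := by
        rcases Nat.eq_zero_or_pos din with h | h
        · subst h; simp at h1
        · exact h
      exact lt_of_lt_of_le
        ((Nat.div_lt_iff_lt_mul hd).2 (lt_of_lt_of_le h1 (le_of_eq (Nat.mul_comm din t0)))) ht⟩
    ⟨(j : ℕ) % din, by
      have h1 := j.isLt
      have hd : 0 < din := by
        rcases Nat.eq_zero_or_pos din with h | h
        · subst h; simp at h1
        · exact h
      exact Nat.mod_lt _ hd⟩

end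

lemma relu_of_nonneg {x : ℝ} (hx : 0 ≤ x) : relu x = x := max_eq_left hx

lemma relu_nonneg (x : ℝ) : 0 ≤ relu x := le_max_right _ _

lemma mulVec_eq_of_row_eq_ite {m n : Type*} [Fintype n] [DecidableEq n] {M : Matrix m n ℝ} {i : m}
    {j : n} (h : ∀ k, M i k = if k = j then 1 else 0) (v : n → ℝ) : M.mulVec v i = v j := by
  simp [Matrix.mulVec, dotProduct, h]

lemma mulVec_eq_zero_of_row_eq_zero {m n : Type*} [Fintype n] {M : Matrix m n ℝ} {i : m}
    (h : ∀ k, M i k = 0) (v : n → ℝ) : M.mulVec v i = 0 := by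
  simp [Matrix.mulVec, dotProduct, h]

lemma applyLayers_concat {D : ℕ} (ls : List (RecLayer D)) (ℓ : RecLayer D)
    (u : ℕ → Fin D → ℝ) : applyLayers (ls ++ [ℓ]) u = ℓ.out (applyLayers ls u) := by
  simp [applyLayers, List.foldl_append]

/-- The sequence `X` delayed by `j` time steps, padded by zeros. -/
noncomputable def delayed {n : ℕ} (X : ℕ → Fin n → ℝ) (j t : ℕ) (i : Fin n) : ℝ :=
  if j ≤ t then X (t - j) i else 0

lemma delayed_nonneg {n : ℕ} {X : ℕ → Fin n → ℝ} (hX : ∀ t i, 0 ≤ X t i) (j t : ℕ) (i : Fin n) :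
    0 ≤ delayed X j t i := by
  unfold delayed
  split_ifs
  exacts [hX _ _, le_rfl]

lemma delayed_succ_zero {n : ℕ} (X : ℕ → Fin n → ℝ) (j : ℕ) (i : Fin n) :
    delayed X (j + 1) 0 i = 0 := by
  simp [delayed]

lemma delayed_succ_succ {n : ℕ} (X : ℕ → Fin n → ℝ) (j t : ℕ) (i : Fin n) :
    delayed X (j + 1) (t + 1) i = delayed X j t i := by
  simp [delayed]

/-- A recurrent layer whose odd coordinates hold the previous value of the preceding even
coordinate. The first `n` even coordinates are passed through, and each later even coordinate
reads the odd coordinate belonging to the pair `n` places earlier. -/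
def shiftLayer (n D : ℕ) : RecLayer D where
  Wh := fun i j => if (i : ℕ) % 2 = 1 ∧ (j : ℕ) + 1 = i then 1 else 0
  Wx := fun i j =>
    if (i : ℕ) % 2 = 0 ∧ (if (i : ℕ) < 2 * n then j = i else (j : ℕ) + 2 * n = i + 1) then 1 else 0
  b := 0
  h0 := 0

lemma shiftLayer_blockDiag (n D : ℕ) {ds : ℕ} (hds : Even ds) :
    (shiftLayer n D).BlockDiag ds := by
  intro i j hij
  simp only [shiftLayer, ite_eq_right_iff, one_ne_zero, imp_false, not_and]
  intro hi hj
  apply hij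
  rw [← hj, Nat.succ_div, if_neg, add_zero]
  intro h
  have := hds.two_dvd.trans h
  omega

lemma shiftLayer_out_even {n D : ℕ} (u : ℕ → Fin D → ℝ) (t a : ℕ) (ha : 2 * a < D) (j : Fin D)
    (hj : if a < n then (j : ℕ) = 2 * a else (j : ℕ) + 2 * n = 2 * a + 1) :
    (shiftLayer n D).out u t ⟨2 * a, ha⟩ = relu (u t j) := by
  simp only [RecLayer.out, RecLayer.state]
  rw [mulVec_eq_zero_of_row_eq_zero, mulVec_eq_of_row_eq_ite (j := j)]
  · simp [shiftLayer]
  · intro k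
    simp only [shiftLayer]
    congr 1
    simp only [Fin.ext_iff]
    split_ifs at hj ⊢ <;> simp <;> omega
  · intro k
    simp [shiftLayer]

lemma shiftLayer_out_odd_zero {n D : ℕ} (u : ℕ → Fin D → ℝ) (a : ℕ) (ha : 2 * a + 1 < D) :
    (shiftLayer n D).out u 0 ⟨2 * a + 1, ha⟩ = 0 := by
  have h₀ : (shiftLayer n D).h0 = 0 := rfl
  simp only [RecLayer.out, RecLayer.state]
  rw [h₀, Matrix.mulVec_zero, mulVec_eq_zero_of_row_eq_zero (M := (shiftLayer n D).Wx)]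
  · simp [shiftLayer, relu]
  · intro k
    simp [shiftLayer, Nat.add_mod]

lemma shiftLayer_out_odd_succ {n D : ℕ} (u : ℕ → Fin D → ℝ) (t a : ℕ) (ha : 2 * a + 1 < D) :
    (shiftLayer n D).out u (t + 1) ⟨2 * a + 1, ha⟩ =
      relu ((shiftLayer n D).out u t ⟨2 * a, by omega⟩) := by
  rw [RecLayer.out, RecLayer.state]
  beta_reduce
  rw [mulVec_eq_zero_of_row_eq_zero (M := (shiftLayer n D).Wx),
    mulVec_eq_of_row_eq_ite (j := ⟨2 * a, by omega⟩)]
  · simp [shiftLayer, RecLayer.out]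
  · intro k
    simp only [shiftLayer]
    congr 1
    simp [Fin.ext_iff]
  · intro k
    simp [shiftLayer, Nat.add_mod]

lemma applyLayers_replicate_shiftLayer {n D : ℕ} {X : ℕ → Fin n → ℝ} (hX : ∀ t i, 0 ≤ X t i)
    {u : ℕ → Fin D → ℝ} (hu : ∀ t (i : Fin n) (h : 2 * (i : ℕ) < D), u t ⟨2 * i, h⟩ = X t i)
    (k : ℕ) :
    (∀ t (i : Fin n) (h : 2 * (i : ℕ) < D),
      applyLayers (List.replicate k (shiftLayer n D)) u t ⟨2 * i, h⟩ = X t i) ∧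
    ∀ j < k, ∀ t (i : Fin n) (h : 2 * (j * n + i) + 1 < D),
      applyLayers (List.replicate k (shiftLayer n D)) u t ⟨2 * (j * n + i), by omega⟩ =
        delayed X j t i ∧
      applyLayers (List.replicate k (shiftLayer n D)) u t ⟨2 * (j * n + i) + 1, h⟩ =
        delayed X (j + 1) t i := by
  induction k with
  | zero => exact ⟨by simpa [applyLayers] using hu, by simp⟩
  | succ k ih =>
    obtain ⟨ih₀, ih₁⟩ := ih
    rw [List.replicate_succ', applyLayers_concat]
    set v := applyLayers (List.replicate k (shiftLayer n D)) u
    have h₀ : ∀ t (i : Fin n) (h : 2 * (i : ℕ) < D),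
        (shiftLayer n D).out v t ⟨2 * i, h⟩ = X t i := by
      intro t i h
      rw [shiftLayer_out_even v t i h ⟨2 * i, h⟩ (by simp), ih₀, relu_of_nonneg (hX _ _)]
    have h₁ : ∀ j < k + 1, ∀ t (i : Fin n) (h : 2 * (j * n + i) < D),
        (shiftLayer n D).out v t ⟨2 * (j * n + i), h⟩ = delayed X j t i := by
      intro j hj t i h
      cases j with
      | zero => simpa [delayed] using h₀ t i (by simpa using h)
      | succ j =>
        have hn := i.pos
        have hmul : (j + 1) * n = j * n + n := by ring
        rw [shiftLayer_out_even v t _ h ⟨2 * (j * n + i) + 1, by omega⟩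
          (by rw [if_neg (by omega)]; simp only; omega), (ih₁ j (by omega) t i (by omega)).2,
          relu_of_nonneg (delayed_nonneg hX _ _ _)]
    refine ⟨h₀, fun j hj t i h => ⟨h₁ j hj t i _, ?_⟩⟩
    cases t with
    | zero => rw [shiftLayer_out_odd_zero, delayed_succ_zero]
    | succ t =>
      rw [shiftLayer_out_odd_succ, h₁ j hj, delayed_succ_succ,
        relu_of_nonneg (delayed_nonneg hX _ _ _)]

/-- The matrix `A` acting on the coordinates selected by `e`. -/
def extendCols {m n D : ℕ} (A : Matrix (Fin m) (Fin n) ℝ) (e : Fin n → Fin D) :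
    Matrix (Fin m) (Fin D) ℝ :=
  fun i j => ∑ b, if j = e b then A i b else 0

lemma extendCols_mulVec {m n D : ℕ} (A : Matrix (Fin m) (Fin n) ℝ) (e : Fin n → Fin D)
    (v : Fin D → ℝ) : (extendCols A e).mulVec v = A.mulVec (v ∘ e) := by
  ext i
  simp only [Matrix.mulVec, dotProduct, extendCols, Finset.sum_mul, ite_mul, zero_mul,
    Function.comp_apply]
  rw [Finset.sum_comm]
  simp

/-- A recurrent layer without recurrence that applies the affine map `A, c` to the coordinates
selected by `e` and stores the result in its first coordinates. -/
def feedforwardLayer {m n D : ℕ} (A : Matrix (Fin m) (Fin n) ℝ) (c : Fin m → ℝ)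
    (e : Fin n → Fin D) : RecLayer D where
  Wh := 0
  Wx := fun i j => if h : (i : ℕ) < m then extendCols A e ⟨i, h⟩ j else 0
  b := fun i => if h : (i : ℕ) < m then c ⟨i, h⟩ else 0
  h0 := 0

lemma feedforwardLayer_out {m n D : ℕ} (A : Matrix (Fin m) (Fin n) ℝ) (c : Fin m → ℝ)
    (e : Fin n → Fin D) (u : ℕ → Fin D → ℝ) (t : ℕ) (h : m ≤ D) (i : Fin m) :
    (feedforwardLayer A c e).out u t (Fin.castLE h i) =
      relu (A.mulVec (u t ∘ e) i + c i) := by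
  have hW : (feedforwardLayer A c e).Wx.mulVec (u t) (Fin.castLE h i) =
      (extendCols A e).mulVec (u t) i := by
    simp [Matrix.mulVec, dotProduct, feedforwardLayer]
  rw [RecLayer.out, RecLayer.state]
  beta_reduce
  rw [hW, extendCols_mulVec]
  simp [feedforwardLayer]

lemma fnnSeq_nonneg (dims : ℕ → ℕ) (A : ∀ l : ℕ, Matrix (Fin (dims (l + 1))) (Fin (dims l)) ℝ)
    (c : ∀ l : ℕ, Fin (dims (l + 1)) → ℝ) {x : Fin (dims 0) → ℝ} (hx : ∀ i, 0 ≤ x i) (l : ℕ)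
    (i : Fin (dims l)) : 0 ≤ fnnSeq dims A c x l i := by
  cases l with
  | zero => exact hx i
  | succ l => exact relu_nonneg _

/-- If recurrent layers bring the input of a feedforward network to the coordinates `e₀` at time
`t`, then `k` further layers bring its `k`-th hidden layer to suitable coordinates. -/
lemma exists_layers_fnnSeq {ι : Type*} {D ds w t : ℕ} (hw : w < D) (dims : ℕ → ℕ)
    (A : ∀ l : ℕ, Matrix (Fin (dims (l + 1))) (Fin (dims l)) ℝ)
    (c : ∀ l : ℕ, Fin (dims (l + 1)) → ℝ) (u : ι → ℕ → Fin D → ℝ) (x : ι → Fin (dims 0) → ℝ)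
    (ls₀ : List (RecLayer D)) (hls₀ : ∀ ℓ ∈ ls₀, ℓ.BlockDiag ds)
    (e₀ : Fin (dims 0) → Fin D) (he₀ : ∀ b, (e₀ b : ℕ) < D - 1)
    (hx : ∀ a b, applyLayers ls₀ (u a) t (e₀ b) = x a b) (k : ℕ)
    (hdims : ∀ l ≤ k, dims l ≤ w) :
    ∃ ls : List (RecLayer D), ls.length = ls₀.length + k ∧ (∀ ℓ ∈ ls, ℓ.BlockDiag ds) ∧
      ∃ e : Fin (dims k) → Fin D, (∀ b, (e b : ℕ) < D - 1) ∧
        ∀ a b, applyLayers ls (u a) t (e b) = fnnSeq dims A c (x a) k b := by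
  induction k with
  | zero => exact ⟨ls₀, rfl, hls₀, e₀, he₀, hx⟩
  | succ k ih =>
    obtain ⟨ls, hlen, hls, e, -, hval⟩ := ih fun l hl => hdims l (by omega)
    have hk := hdims (k + 1) le_rfl
    refine ⟨ls ++ [feedforwardLayer (A k) (c k) e], by simp [hlen, add_assoc], ?_,
      Fin.castLE (by omega), fun b => ?_, fun a b => ?_⟩
    · intro ℓ hℓ
      rcases List.mem_append.1 hℓ with h | h
      · exact hls ℓ h
      · rw [List.mem_singleton.1 h]
        exact fun _ _ _ => rfl
    · have := b.isLt
      simp only [Fin.val_castLE]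
      omega
    · rw [applyLayers_concat, feedforwardLayer_out, fnnSeq]
      congr 3
      ext b'
      exact hval a b'

/-- An affine read-out of nonnegative coordinates of the last recurrent layer is realized by the
final two maps of a deep ParaRNN, using the last coordinate to carry the bias. -/
lemma exists_paraNet_affine {ι : Type*} {din dout D ds N n t : ℕ} (hD : 0 < D)
    (P : Matrix (Fin D) (Fin din) ℝ) (X : ι → ℕ → Fin din → ℝ)
    (ls : List (RecLayer D)) (hlen : ls.length = N) (hls : ∀ ℓ ∈ ls, ℓ.BlockDiag ds)
    (A : Matrix (Fin dout) (Fin n) ℝ) (c : Fin dout → ℝ)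
    (e : Fin n → Fin D) (he : ∀ b, (e b : ℕ) < D - 1) (y : ι → Fin n → ℝ) (hy : ∀ a b, 0 ≤ y a b)
    (hval : ∀ a b, applyLayers ls (fun s => P.mulVec (X a s)) t (e b) = y a b) :
    ∃ net : ParaNet din dout D ds N, ∀ a i, net.forward (X a) t i = A.mulVec (y a) i + c i := by
  subst hlen
  let last : Fin D := ⟨D - 1, by omega⟩
  have hne : ∀ b, e b ≠ last := fun b h => (he b).ne (congrArg Fin.val h)
  let W : Matrix (Fin D) (Fin D) ℝ :=
    Matrix.of fun i j => if i = last then 0 else if j = i then 1 else 0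
  refine ⟨⟨P, ls.get, fun l => hls _ (List.get_mem _ _), W, Pi.single last 1,
    extendCols A e + Matrix.of fun i j => if j = last then c i else 0⟩, fun a i => ?_⟩
  simp only [ParaNet.forward, List.ofFn_get, Matrix.add_mulVec, Pi.add_apply, extendCols_mulVec]
  congr 1
  · refine congrFun (congrArg A.mulVec (funext fun b => ?_)) i
    rw [Function.comp_apply,
      mulVec_eq_of_row_eq_ite (M := W) (j := e b) (fun k => by simp [W, hne]), hval]
    simp [hne, relu_of_nonneg (hy a b)]
  · have hlast := mulVec_eq_zero_of_row_eq_zero (M := W) (i := last) (by simp [W])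
      (applyLayers ls (fun s => P.mulVec (X a s)) t)
    rw [Matrix.mulVec, dotProduct]
    simp [hlast, relu]

/-- **FNNs can be represented by deep ParaRNNs.** Let `t0 ∈ {1,…,T}` and let `ds` be an
even positive integer dividing `(din + 1)d`. For any ReLU feedforward network
`Ñ ∈ FNN_{din·t0, dout}(d, L)` there is a deep ParaRNN `N` with input dimension `din`,
output dimension `dout`, width `(din + 1)d + ds`, block size `ds`, and depth
`2(T + L − 1)` such that `Ñ(x_1,…,x_{t0}) = N(X)[t0]` for every `X ∈ [0,1]^{din×T}`. -/
theorem stmt15 (din dout d ds T L t0 : ℕ)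
    (hds0 : 0 < ds) (hds : Even ds) (hdvd : ds ∣ (din + 1) * d)
    (ht0 : 1 ≤ t0) (ht0T : t0 ≤ T) (hL : 1 ≤ L)
    (g : (Fin (din * t0) → ℝ) → Fin dout → ℝ)
    (hg : MemFNN (din * t0) dout d L g) :
    ∃ net : ParaNet din dout ((din + 1) * d + ds) ds (2 * (T + L - 1)),
      ∀ X : Fin T → Fin din → ℝ, (∀ t i, X t i ∈ Set.Icc (0 : ℝ) 1) →
        ∀ i, g (vecCols t0 ht0T X) i = net.forward (extendInput X) (t0 - 1) i := by
  obtain ⟨dims, h0, rfl, A, c, hdims, hg⟩ := hg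
  obtain ⟨L, rfl⟩ : ∃ l, L = l + 1 := ⟨L - 1, by omega⟩
  set D := (din + 1) * d + ds with hDdef
  have hds2 : 2 ≤ ds := Nat.le_of_dvd hds0 hds.two_dvd
  have hdD : d < D := by nlinarith [Nat.zero_le (din * d)]
  have hp : din * t0 ≤ d := h0 ▸ hdims 0 (Nat.zero_le _)
  let P : Matrix (Fin D) (Fin din) ℝ := fun i k => if k.val * 2 = i.val then 1 else 0
  let ι := {X : Fin T → Fin din → ℝ // ∀ t i, X t i ∈ Set.Icc (0 : ℝ) 1}
  let s := 2 * T + L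
  have hidx : ∀ b : Fin (dims 0), 2 * ((t0 - 1 - b / din) * din + b % din) + 1 < D - 1 := by
    intro b
    have hb : (b : ℕ) < din * t0 := h0 ▸ b.isLt
    have hdin : 0 < din := Nat.pos_of_ne_zero (by rintro rfl; simp at hb)
    have h1 := Nat.mod_lt (b : ℕ) hdin
    have h2 : (t0 - 1 - b / din) * din ≤ (t0 - 1) * din := Nat.mul_le_mul_right _ (Nat.sub_le _ _)
    have h3 : (t0 - 1) * din + din = din * t0 := by
      rw [← Nat.succ_mul, Nat.succ_eq_add_one, Nat.sub_add_cancel ht0, mul_comm]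
    have h4 : 2 * d ≤ (din + 1) * d := Nat.mul_le_mul_right _ (by omega)
    omega
  have hX0 : ∀ X : ι, ∀ t i, 0 ≤ extendInput X.1 t i := by
    intro X t i
    unfold extendInput
    split_ifs
    exacts [(X.2 _ _).1, le_rfl]
  obtain ⟨ls, hlen, hls, e, he, hval⟩ := exists_layers_fnnSeq (ι := ι) (ds := ds) (t := t0 - 1)
    hdD dims A c (fun X s => P.mulVec (extendInput X.1 s))
    (fun X j => vecCols t0 ht0T X.1 (Fin.cast h0 j)) (List.replicate s (shiftLayer din D))
    (fun ℓ hℓ => (List.eq_of_mem_replicate hℓ) ▸ shiftLayer_blockDiag din D hds)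
    (fun b => ⟨2 * ((t0 - 1 - b / din) * din + b % din), by have := hidx b; omega⟩)
    (fun b => by have := hidx b; simp only; omega)
    (by
      intro X b
      have hb : (b : ℕ) < din * t0 := h0 ▸ b.isLt
      have hdin : 0 < din := Nat.pos_of_ne_zero (by rintro rfl; simp at hb)
      have hq : (b : ℕ) / din < t0 := Nat.div_lt_of_lt_mul hb
      have key := ((applyLayers_replicate_shiftLayer (hX0 X)
        (u := fun s => P.mulVec (extendInput X.1 s))
        (fun t i h => mulVec_eq_of_row_eq_ite
          (fun k => by
            simp only [P, Fin.ext_iff]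
            congr 1
            simp only [eq_iff_iff]
            omega) _) s).2
        (t0 - 1 - b / din) ((Nat.sub_le _ _).trans_lt (by simp only [s]; omega)) (t0 - 1) ⟨b % din, Nat.mod_lt _ hdin⟩
        (by have := hidx b; simp only; omega)).1
      refine key.trans ?_
      have hsub : t0 - 1 - (t0 - 1 - (b : ℕ) / din) = b / din :=
        Nat.sub_sub_self (Nat.le_sub_one_of_lt hq)
      rw [delayed, if_pos (Nat.sub_le _ _), hsub]
      simp only [extendInput, vecCols, Fin.val_cast]
      rw [dif_pos (hq.trans_le ht0T)])
    L (fun l hl => hdims l (by omega))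
  obtain ⟨net, hnet⟩ := exists_paraNet_affine (ι := ι) (N := 2 * (T + (L + 1) - 1)) (by omega) P
    (fun X => extendInput X.1) ls (by rw [hlen, List.length_replicate]; omega) hls (A L) (c L) e he
    _ (fun X b => fnnSeq_nonneg dims A c (fun i => (X.2 _ _).1) L b) hval
  refine ⟨net, fun X hX i => ?_⟩
  rw [hg]
  exact (hnet ⟨X, hX⟩ i).symm
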